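/- Let n ≥ 3 be a fixed integer and 0 < ξ < 1. Then for every t ∈ ℝ with |t| ≥ √(5(n−1)/ξ), one has ∫_{G_{n−1}(t)} |ξ t^{n−1} + Σ_{k=1}^{n−1} k q_k t^{k−1}| dq_1⋯dq_{n−1} = 2^{n−1} ξ. -/

import Mathlib

open MeasureTheory

/-- The domain `G_n(t) ⊆ ℝ^n`: vectors `(q_1, …, q_n)` (indexed by `i : Fin n`, where `q i`
stands for `q_{i+1}`) with `|q_i| ≤ 1` and `|∑_{k=1}^{n} q_k t^k| ≤ 1`. -/
def Gset (n : ℕ) (t : ℝ) : Set (Fin n → ℝ) :=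
  {q | (∀ i, |q i| ≤ 1) ∧ |∑ i, q i * t ^ ((i : ℕ) + 1)| ≤ 1}


lemma aux_geom (r : ℝ) (hr : 3 ≤ r) (m : ℕ) :
    2 * (r * ∑ j ∈ Finset.range m, r ^ j) ≤ 3 * r ^ m := by
  induction m with
  | zero => simp
  | succ k ih =>
    rw [Finset.sum_range_succ, pow_succ]
    have : 0 < r ^ k := by positivity
    nlinarith

lemma aux_sum_le (m : ℕ) (t : ℝ) (c q : Fin m → ℝ) (C : ℝ) (hC : 0 ≤ C) (hc : ∀ i, |c i| ≤ C)
    (hq : ∀ i, |q i| ≤ 1) :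
    |∑ i : Fin m, c i * q i * t ^ ((i : ℕ) + 1)| ≤
      C * (|t| * ∑ j ∈ Finset.range m, |t| ^ j) := by
  calc |∑ i : Fin m, c i * q i * t ^ ((i : ℕ) + 1)|
      ≤ ∑ i : Fin m, |c i * q i * t ^ ((i : ℕ) + 1)| := Finset.abs_sum_le_sum_abs _ _
    _ ≤ ∑ i : Fin m, C * (|t| * |t| ^ (i : ℕ)) := by
      apply Finset.sum_le_sum
      intro i _
      rw [abs_mul, abs_mul, abs_pow, pow_succ']
      have h := mul_le_mul (hc i) (hq i) (abs_nonneg _) hC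
      rw [mul_one] at h
      exact mul_le_mul_of_nonneg_right h (by positivity)
    _ = _ := by
      rw [← Finset.mul_sum, ← Finset.mul_sum, Fin.sum_univ_eq_sum_range (fun j => |t| ^ j)]

def auxM (m : ℕ) (t : ℝ) : Matrix (Fin (m + 1)) (Fin (m + 1)) ℝ :=
  fun i j => if i = Fin.last m then t ^ ((j : ℕ) + 1) else if i = j then 1 else 0

lemma auxM_det (m : ℕ) (t : ℝ) : (auxM m t).det = t ^ (m + 1) := by
  rw [Matrix.det_of_lowerTriangular]
  · rw [Fin.prod_univ_castSucc]
    simp [auxM, (Fin.castSucc_lt_last _).ne]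
  · intro i j hij
    have hij : i < j := hij
    have : i ≠ Fin.last m := (lt_of_lt_of_le hij (Fin.le_last j)).ne
    simp [auxM, this, hij.ne]

lemma Gset_eq (m : ℕ) (t : ℝ) (ht : 3 ≤ |t|) :
    Gset (m + 1) t = (Matrix.toLin' (auxM m t)) ⁻¹' (Set.Icc (fun _ => -1) (fun _ => 1)) := by
  ext q
  have hlast : Matrix.toLin' (auxM m t) q (Fin.last m) = ∑ i, q i * t ^ ((i : ℕ) + 1) := by
    simp [Matrix.toLin'_apply, Matrix.mulVec, dotProduct, auxM, mul_comm]
  have hcast : ∀ i : Fin m, Matrix.toLin' (auxM m t) q i.castSucc = q i.castSucc := by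
    intro i
    simp [Matrix.toLin'_apply, Matrix.mulVec, dotProduct, auxM, (Fin.castSucc_lt_last i).ne]
  have hmem : (q ∈ (Matrix.toLin' (auxM m t)) ⁻¹' (Set.Icc (fun _ => -1) (fun _ => 1))) ↔
      (∀ i : Fin m, |q i.castSucc| ≤ 1) ∧ |∑ i, q i * t ^ ((i : ℕ) + 1)| ≤ 1 := by
    rw [Set.mem_preimage, Set.mem_Icc, Pi.le_def, Pi.le_def, ← forall_and,
      Fin.forall_fin_succ', hlast]
    simp only [hcast, abs_le]
  rw [hmem]
  constructor
  · rintro ⟨h1, h2⟩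
    exact ⟨fun i => h1 _, h2⟩
  · rintro ⟨h1, h2⟩
    refine ⟨?_, h2⟩
    rw [Fin.forall_fin_succ']
    refine ⟨h1, ?_⟩
    rw [Fin.sum_univ_castSucc] at h2
    have h3 := aux_sum_le m t (fun _ => 1) (fun i => q i.castSucc) 1 (by norm_num)
      (by simp) h1
    have h4 := aux_geom |t| ht m
    simp only [one_mul, Fin.val_castSucc, Fin.val_last] at h2 h3
    have h5 : |q (Fin.last m) * t ^ (m + 1)| ≤
        1 + |t| * ∑ j ∈ Finset.range m, |t| ^ j := by
      rw [abs_le] at *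
      constructor <;> linarith [h2.1, h2.2, h3.1, h3.2]
    rw [abs_mul, abs_pow, pow_succ] at h5
    have h6 : 1 ≤ |t| ^ m := one_le_pow₀ (by linarith)
    by_contra hcon
    push Not at hcon
    nlinarith [mul_le_mul_of_nonneg_left ht (zero_le_one.trans h6),
      mul_pos (sub_pos.2 hcon) (show 0 < |t| ^ m * |t| by positivity)]

lemma Gset_vol (m : ℕ) (t : ℝ) (ht : 3 ≤ |t|) :
    volume (Gset (m + 1) t) = ENNReal.ofReal (2 ^ (m + 1) / |t| ^ (m + 1)) := by
  have ht0 : t ≠ 0 := by rintro rfl; norm_num at ht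
  rw [Gset_eq m t ht, Measure.addHaar_preimage_linearMap]
  · rw [LinearMap.det_toLin', auxM_det, Real.volume_Icc_pi, Finset.prod_const,
      ← ENNReal.ofReal_pow (by norm_num), ← ENNReal.ofReal_mul (by positivity)]
    congr 1
    simp only [Finset.card_univ, Fintype.card_fin, abs_inv, abs_pow]
    norm_num
    ring
  · rw [LinearMap.det_toLin', auxM_det]
    positivity

lemma aux_sign (m : ℕ) (ξ t : ℝ) (ht : 3 ≤ |t|) (hξ : 5 * ((m : ℝ) + 1) ≤ ξ * |t| ^ 2)
    (q : Fin (m + 1) → ℝ) (hq : q ∈ Gset (m + 1) t) :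
    |∑ i : Fin (m + 1), ((i : ℕ) + 1 : ℝ) * q i * t ^ (i : ℕ)| ≤ ξ * |t| ^ (m + 1) := by
  obtain ⟨h1, h2⟩ := hq
  set L := ∑ i : Fin (m + 1), ((i : ℕ) + 1 : ℝ) * q i * t ^ (i : ℕ) with hL
  have e : t * L = (m + 1) * (∑ i, q i * t ^ ((i : ℕ) + 1)) +
      ∑ i : Fin m, ((i : ℕ) - m : ℝ) * q i.castSucc * t ^ ((i : ℕ) + 1) := by
    have : ∑ i : Fin m, ((i : ℕ) - m : ℝ) * q i.castSucc * t ^ ((i : ℕ) + 1) =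
        ∑ i : Fin (m + 1), ((i : ℕ) - m : ℝ) * q i * t ^ ((i : ℕ) + 1) := by
      rw [Fin.sum_univ_castSucc]; simp
    rw [this, hL, Finset.mul_sum, Finset.mul_sum, ← Finset.sum_add_distrib]
    apply Finset.sum_congr rfl
    intro i _
    ring
  have h3 := aux_sum_le m t (fun i => ((i : ℕ) - m : ℝ)) (fun i => q i.castSucc) m (by positivity)
      (by
        intro i
        have : ((i : ℕ) : ℝ) ≤ m := by exact_mod_cast i.2.le
        have h0 : (0 : ℝ) ≤ ((i : ℕ) : ℝ) := by positivity
        rw [abs_le]; constructor <;> linarith) (fun i => h1 _)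
  have h4 := aux_geom |t| ht m
  have h5 : |t| * |L| ≤ (m + 1) + m * (|t| * ∑ j ∈ Finset.range m, |t| ^ j) := by
    rw [← abs_mul, e]
    refine (abs_add_le _ _).trans (add_le_add ?_ h3)
    rw [abs_mul, abs_of_nonneg (by positivity : (0 : ℝ) ≤ m + 1)]
    nlinarith
  have h6 : 1 ≤ |t| ^ m := one_le_pow₀ (by linarith)
  have hm : (0 : ℝ) ≤ m := by positivity
  have h7 := mul_le_mul_of_nonneg_left h4 hm
  have h8 := mul_le_mul_of_nonneg_right hξ (zero_le_one.trans h6)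
  have h9 : (m : ℝ) + 1 ≤ (m + 1) * |t| ^ m := le_mul_of_one_le_right (by positivity) h6
  have h10 : 0 ≤ (m : ℝ) * |t| ^ m := by positivity
  have h11 : |t| * |L| ≤ |t| * (ξ * |t| ^ (m + 1)) := by
    have : |t| * (ξ * |t| ^ (m + 1)) = ξ * |t| ^ 2 * |t| ^ m := by ring
    rw [this]
    nlinarith
  exact le_of_mul_le_mul_left h11 (by linarith)

lemma aux_odd (m : ℕ) (t : ℝ) (hG : MeasurableSet (Gset (m + 1) t)) :
    ∫ q in Gset (m + 1) t, (∑ i : Fin (m + 1), ((i : ℕ) + 1 : ℝ) * q i * t ^ (i : ℕ)) = 0 := by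
  rw [← integral_indicator hG]
  set f := (Gset (m + 1) t).indicator
    (fun q => ∑ i : Fin (m + 1), ((i : ℕ) + 1 : ℝ) * q i * t ^ (i : ℕ)) with hf
  have hodd : ∀ q, f (-q) = - f q := by
    intro q
    have hm : -q ∈ Gset (m + 1) t ↔ q ∈ Gset (m + 1) t := by
      simp [Gset]
    by_cases h : q ∈ Gset (m + 1) t
    · simp [hf, h, hm.2 h]
    · simp [hf, h, mt hm.1 h]
  have h := integral_neg_eq_self f (volume : Measure (Fin (m + 1) → ℝ))
  simp only [hodd, integral_neg] at h
  linarith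

lemma aux_main (m : ℕ) (ξ t : ℝ) (ht : 3 ≤ |t|) (hξ : 5 * ((m : ℝ) + 1) ≤ ξ * |t| ^ 2) :
    (∫ q in Gset (m + 1) t,
        |ξ * t ^ (m + 1) + ∑ i : Fin (m + 1), ((i : ℕ) + 1 : ℝ) * q i * t ^ (i : ℕ)|) =
      2 ^ (m + 1) * ξ := by
  have ht0 : t ≠ 0 := by rintro rfl; norm_num at ht
  have hG : MeasurableSet (Gset (m + 1) t) := by
    rw [Gset_eq m t ht]
    exact measurableSet_Icc.preimage (LinearMap.continuous_of_finiteDimensional _).measurable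
  have hvol := Gset_vol m t ht
  have hfin : volume (Gset (m + 1) t) ≠ ⊤ := by rw [hvol]; exact ENNReal.ofReal_ne_top
  obtain ⟨s, hs, hst⟩ : ∃ s : ℝ, |s| = 1 ∧ s * t ^ (m + 1) = |t| ^ (m + 1) := by
    rw [← abs_pow]
    rcases abs_choice (t ^ (m + 1)) with h | h
    · exact ⟨1, by simp, by rw [h]; ring⟩
    · exact ⟨-1, by simp, by rw [h]; ring⟩
  have key : ∀ q ∈ Gset (m + 1) t,
      |ξ * t ^ (m + 1) + ∑ i : Fin (m + 1), ((i : ℕ) + 1 : ℝ) * q i * t ^ (i : ℕ)| =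
      ξ * |t| ^ (m + 1) + s * ∑ i : Fin (m + 1), ((i : ℕ) + 1 : ℝ) * q i * t ^ (i : ℕ) := by
    intro q hq
    have hb := aux_sign m ξ t ht hξ q hq
    set L := ∑ i : Fin (m + 1), ((i : ℕ) + 1 : ℝ) * q i * t ^ (i : ℕ)
    have hsL : |s * L| ≤ ξ * |t| ^ (m + 1) := by rw [abs_mul, hs, one_mul]; exact hb
    rw [← one_mul |ξ * t ^ (m + 1) + L|, ← hs, ← abs_mul]
    have : s * (ξ * t ^ (m + 1) + L) = ξ * |t| ^ (m + 1) + s * L := by rw [← hst]; ring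
    rw [this, abs_of_nonneg]
    linarith [(abs_le.1 hsL).1]
  have hint : IntegrableOn
      (fun q : Fin (m + 1) → ℝ => ∑ i : Fin (m + 1), ((i : ℕ) + 1 : ℝ) * q i * t ^ (i : ℕ))
      (Gset (m + 1) t) := by
    refine IntegrableOn.of_bound (lt_top_iff_ne_top.2 hfin) ?_ (ξ * |t| ^ (m + 1)) ?_
    · exact (by fun_prop : Continuous _).aestronglyMeasurable
    · exact (ae_restrict_iff' hG).2 (Filter.Eventually.of_forall
        (fun q hq => aux_sign m ξ t ht hξ q hq))
  have hc : Integrable (fun _ : Fin (m + 1) → ℝ => ξ * |t| ^ (m + 1))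
      (volume.restrict (Gset (m + 1) t)) := integrableOn_const hfin
  rw [setIntegral_congr_fun hG key, integral_add hc (Integrable.const_mul hint s),
    integral_const_mul s, aux_odd m t hG, setIntegral_const, measureReal_def, hvol,
    ENNReal.toReal_ofReal (by positivity)]
  have : |t| ^ (m + 1) ≠ 0 := by positivity
  simp only [smul_eq_mul]
  field_simp
  ring

theorem integral_eq_of_large_t (n : ℕ) (hn : 3 ≤ n) (ξ : ℝ) (h0 : 0 < ξ) (h1 : ξ < 1)
    (t : ℝ) (ht : Real.sqrt (5 * (n - 1) / ξ) ≤ |t|) :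
    (∫ q in Gset (n - 1) t,
        |ξ * t ^ (n - 1) + ∑ i : Fin (n - 1), ((i : ℕ) + 1 : ℝ) * q i * t ^ (i : ℕ)|) =
      2 ^ (n - 1) * ξ := by
  obtain ⟨m, rfl⟩ : ∃ m, n = m + 1 + 1 := ⟨n - 2, by omega⟩
  have hm : (1 : ℝ) ≤ m := by exact_mod_cast (by omega : 1 ≤ m)
  have h2 := (Real.sqrt_le_left (abs_nonneg t)).1 ht
  rw [div_le_iff₀ h0] at h2
  push_cast at h2
  have h3 : 3 ≤ |t| := by
    by_contra hc
    push Not at hc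
    have : |t| ^ 2 < 9 := by nlinarith [abs_nonneg t]
    nlinarith [sq_nonneg |t|]
  exact aux_main m ξ t h3 (by linarith)
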